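/- Let λ > 0, ν > 0, G > 0, b₁ > 0, b₂ ≥ 0, s₁ > 0, s₂ ≥ 0 with ρ := λ b₁ ∈ (0,1), and set u = e^{−νG}. Define: EX = (λ s₁ + λ ρ G)/((1 − ρ)(1 − u)); EXX1 = K″/((1−ρ)(1−u)(1+ρ(1−u)+u)) + K′(2K′(ρ(1−u)+u) + (1−u)λ²b₂)/((1−ρ)²(1−u)²(1+ρ(1−u)+u)) where K′ = λ s₁ + λ ρ G and K″ = λ² s₂ + 2ρλ²G s₁ + λ³ G b₂ + (λGρ)²; EZ = EX − λ s₁; EYq = λG + (1−u) EX; EYqYo = λ G u EX + (1−u) u EXX1; EYqYq1 = (λG)² + (1−u)² EXX1 + 2λG(1−u) EX; ERva = EZ + λ s₂/(2 s₁); ERgl = EX + λ G/2; ERvi = 1 + λ b₂/(2 b₁) + EYqYo/EYq + (1+ρ) EYqYq1/(2 EYq); and ER = ρ ERvi + (1−ρ)(G/(G+s₁)) ERgl + (1−ρ)(s₁/(G+s₁)) ERva. Then ER = ρ + λ² b₂/(2(1−ρ)) + λ(G² + 2 G s₁ + s₂)/(2(G + s₁)) + λ ρ (G + s₁)/(1−ρ)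 + λ(ρ G + s₁) u/((1−ρ)(1−u)). -/

import Mathlib

/-- Combining the mean numbers of customers at arbitrary epochs of
vacation, glue and visit periods yields the closed-form expression (2.25) for
the stationary mean number of customers `𝔼[R]` in the single retrial queue with
vacations and glue periods. -/
theorem mean_number_closed_form
    (lam ν G b₁ b₂ s₁ s₂ ρ u : ℝ)
    (hlam : 0 < lam) (hν : 0 < ν) (hG : 0 < G)
    (hb₁ : 0 < b₁) (hb₂ : 0 ≤ b₂) (hs₁ : 0 < s₁) (hs₂ : 0 ≤ s₂)
    (hρdef : ρ = lam * b₁) (hρ0 : 0 < ρ) (hρ1 : ρ < 1)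
    (hu : u = Real.exp (-ν * G))
    (EX EXX1 K' K'' EZ EYq EYqYo EYqYq1 ERva ERgl ERvi ER : ℝ)
    (hK' : K' = lam * s₁ + lam * ρ * G)
    (hK'' : K'' = lam ^ 2 * s₂ + 2 * ρ * lam ^ 2 * G * s₁ + lam ^ 3 * G * b₂
                  + (lam * G * ρ) ^ 2)
    (hEX : EX = (lam * s₁ + lam * ρ * G) / ((1 - ρ) * (1 - u)))
    (hEXX1 : EXX1 = K'' / ((1 - ρ) * (1 - u) * (1 + ρ * (1 - u) + u))
        + K' * (2 * K' * (ρ * (1 - u) + u) + (1 - u) * lam ^ 2 * b₂)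
          / ((1 - ρ) ^ 2 * (1 - u) ^ 2 * (1 + ρ * (1 - u) + u)))
    (hEZ : EZ = EX - lam * s₁)
    (hEYq : EYq = lam * G + (1 - u) * EX)
    (hEYqYo : EYqYo = lam * G * u * EX + (1 - u) * u * EXX1)
    (hEYqYq1 : EYqYq1 = (lam * G) ^ 2 + (1 - u) ^ 2 * EXX1
                        + 2 * lam * G * (1 - u) * EX)
    (hERva : ERva = EZ + lam * s₂ / (2 * s₁))
    (hERgl : ERgl = EX + lam * G / 2)
    (hERvi : ERvi = 1 + lam * b₂ / (2 * b₁) + EYqYo / EYq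
                    + (1 + ρ) * EYqYq1 / (2 * EYq))
    (hER : ER = ρ * ERvi + (1 - ρ) * (G / (G + s₁)) * ERgl
                + (1 - ρ) * (s₁ / (G + s₁)) * ERva) :
    ER = ρ + lam ^ 2 * b₂ / (2 * (1 - ρ))
        + lam * (G ^ 2 + 2 * G * s₁ + s₂) / (2 * (G + s₁))
        + lam * ρ * (G + s₁) / (1 - ρ)
        + lam * (ρ * G + s₁) * u / ((1 - ρ) * (1 - u)) := by
  have hu0 : 0 < u := hu ▸ Real.exp_pos _
  have hu1 : u < 1 := by
    rw [hu, Real.exp_lt_one_iff]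
    nlinarith [mul_pos hν hG]
  have hv : 1 - u ≠ 0 := by linarith
  have hρ : 1 - ρ ≠ 0 := by linarith
  have hGs : G + s₁ ≠ 0 := by positivity
  have hD : 1 + (1 - u) * ρ + u ≠ 0 := by
    nlinarith [mul_pos hρ0 (sub_pos.mpr hu1)]
  have hYq : EYq = lam * (G + s₁) / (1 - ρ) := by
    rw [hEYq, hEX]
    field_simp
    ring
  have hXX1 : (1 - u) * (1 + ρ * (1 - u) + u) * EXX1 = K'' / (1 - ρ)
      + K' * (2 * K' * (ρ * (1 - u) + u) + (1 - u) * lam ^ 2 * b₂)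
        / ((1 - ρ) ^ 2 * (1 - u)) := by
    rw [hEXX1]
    field_simp
  have hsum : EYqYo / EYq + (1 + ρ) * EYqYq1 / (2 * EYq)
      = (2 * lam * G * (u + (1 + ρ) * (1 - u)) * EX + (1 + ρ) * (lam * G) ^ 2
        + (1 - u) * (1 + ρ * (1 - u) + u) * EXX1) / (2 * EYq) := by
    have hYq0 : EYq ≠ 0 := by
      rw [hYq]
      positivity
    rw [hEYqYo, hEYqYq1]
    field_simp
    ring
  rw [hER, hERvi, add_assoc (1 + _), hsum, hXX1, hERgl, hERva, hEZ, hYq, hEX, hK', hK'', hρdef]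
  rw [hρdef] at hρ
  field_simp
  ring
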